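/- Let S ⊆ ℤ and K > 0 be such that S satisfies the Λ(4) inequality with constant K. Then for every nonempty finite subset S' ⊆ S, |S' + S'| ≥ |S'|²/K⁴ and |S' − S'| ≥ |S'|²/K⁴. -/

import Mathlib

open scoped Pointwise

/-- `S ⊆ ℤ` satisfies the `Λ(4)` inequality with constant `K`: for every finitely
supported `f : ℤ → ℂ` with support contained in `S`, the `L⁴` norm (w.r.t. the Haar
probability measure on `ℝ/ℤ`) of the trigonometric polynomial with coefficients `f`
is at most `K` times its `L²` norm `(Σ |f ξ|²)^{1/2}`. -/
def SatisfiesLambda4 (S : Set ℤ) (K : ℝ) : Prop :=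
  ∀ f : ℤ →₀ ℂ, (↑f.support : Set ℤ) ⊆ S →
    MeasureTheory.eLpNorm
      (fun x : AddCircle (1 : ℝ) => ∑ ξ ∈ f.support, f ξ * fourier ξ x) 4
      AddCircle.haarAddCircle
      ≤ ENNReal.ofReal (K * Real.sqrt (∑ ξ ∈ f.support, ‖f ξ‖ ^ 2))

lemma l4_integral_fourier (n : ℤ) :
    ∫ x : AddCircle (1 : ℝ), (fourier n x : ℂ) ∂AddCircle.haarAddCircle = if n = 0 then 1 else 0 := by
  have h := congrFun (fourierCoeff_fourier (T := (1 : ℝ)) n) 0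
  simp only [fourierCoeff, neg_zero, fourier_zero, one_smul, Pi.single_apply] at h
  rw [h]
  simp only [eq_comm]

lemma l4_pointwise (A : Finset ℤ) (x : AddCircle (1 : ℝ)) :
    ((‖∑ ξ ∈ A, (fourier ξ x : ℂ)‖ ^ 4 : ℝ) : ℂ) =
      ∑ p ∈ (A ×ˢ A) ×ˢ A ×ˢ A, (fourier (p.1.1 + p.2.1 - (p.1.2 + p.2.2)) x : ℂ) := by
  have h1 : ((‖∑ ξ ∈ A, (fourier ξ x : ℂ)‖ ^ 2 : ℝ) : ℂ) =
      ∑ p ∈ A ×ˢ A, (fourier (p.1 - p.2) x : ℂ) := by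
    push_cast
    rw [← Complex.mul_conj', map_sum, Finset.sum_mul_sum, Finset.sum_product]
    refine Finset.sum_congr rfl fun a _ => Finset.sum_congr rfl fun b _ => ?_
    rw [← fourier_neg, ← fourier_add, sub_eq_add_neg]
  have h2 : (‖∑ ξ ∈ A, (fourier ξ x : ℂ)‖ ^ 4 : ℝ) =
    (‖∑ ξ ∈ A, (fourier ξ x : ℂ)‖ ^ 2) * (‖∑ ξ ∈ A, (fourier ξ x : ℂ)‖ ^ 2) := by ring
  rw [h2, Complex.ofReal_mul, h1, Finset.sum_mul_sum, Finset.sum_product (A ×ˢ A) (A ×ˢ A)]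
  refine Finset.sum_congr rfl fun a _ => Finset.sum_congr rfl fun b _ => ?_
  rw [← fourier_add]
  congr 2
  ring

lemma l4_integral (A : Finset ℤ) :
    ∫ x : AddCircle (1 : ℝ), ‖∑ ξ ∈ A, (fourier ξ x : ℂ)‖ ^ 4 ∂AddCircle.haarAddCircle
      = (Finset.addEnergy A A : ℝ) := by
  have : ((∫ x : AddCircle (1 : ℝ), ‖∑ ξ ∈ A, (fourier ξ x : ℂ)‖ ^ 4
      ∂AddCircle.haarAddCircle : ℝ) : ℂ) = ((Finset.addEnergy A A : ℝ) : ℂ) := by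
    rw [← integral_complex_ofReal]
    simp_rw [l4_pointwise]
    rw [MeasureTheory.integral_finsetSum]
    · simp_rw [l4_integral_fourier, sub_eq_zero]
      simp [Finset.addEnergy]
    · intro p _
      exact (ContinuousMap.continuous _).integrable_of_hasCompactSupport
        (HasCompactSupport.of_compactSpace _)
  exact_mod_cast this

lemma l4_energy_le (S : Set ℤ) (K : ℝ) (hK : 0 < K) (hS : SatisfiesLambda4 S K)
    (A : Finset ℤ) (hA : (A : Set ℤ) ⊆ S) :
    (Finset.addEnergy A A : ℝ) ≤ K ^ 4 * (A.card : ℝ) ^ 2 := by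
  classical
  let f : ℤ →₀ ℂ := Finsupp.onFinset A (fun n => if n ∈ A then 1 else 0) (by intro a; simp)
  have hf : f.support = A := by ext a; simp [f]
  have h := hS f (by rw [hf]; exact hA)
  rw [hf] at h
  have e1 : (fun x : AddCircle (1 : ℝ) => ∑ ξ ∈ A, f ξ * (fourier ξ x : ℂ)) =
      fun x => ∑ ξ ∈ A, (fourier ξ x : ℂ) := by
    funext x
    exact Finset.sum_congr rfl fun a ha => by simp [f, ha]
  have e2 : ∑ ξ ∈ A, ‖f ξ‖ ^ 2 = (A.card : ℝ) := by
    rw [Finset.sum_congr rfl (g := fun _ => (1 : ℝ)) fun a ha => by simp [f, ha]]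
    simp
  have hc : Continuous (fun x : AddCircle (1 : ℝ) => ∑ ξ ∈ A, (fourier ξ x : ℂ)) := by
    fun_prop
  have hm : MeasureTheory.MemLp (fun x : AddCircle (1 : ℝ) => ∑ ξ ∈ A, (fourier ξ x : ℂ)) 4
      AddCircle.haarAddCircle :=
    hc.memLp_of_hasCompactSupport (HasCompactSupport.of_compactSpace _)
  rw [e1, e2, hm.eLpNorm_eq_integral_rpow_norm (by norm_num) (by norm_num),
    ENNReal.ofReal_le_ofReal_iff (by positivity)] at h
  have e4 : (4 : ENNReal).toReal = ((4 : ℕ) : ℝ) := by norm_num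
  simp_rw [e4, Real.rpow_natCast, l4_integral] at h
  have h' := pow_le_pow_left₀ (by positivity) h 4
  rw [Real.rpow_inv_natCast_pow (by positivity) (by norm_num)] at h'
  refine h'.trans (le_of_eq ?_)
  rw [mul_pow, show (4 : ℕ) = 2 * 2 from rfl, pow_mul (Real.sqrt _), Real.sq_sqrt (by positivity)]

lemma l4_energy_neg (A : Finset ℤ) : Finset.addEnergy A (-A) = Finset.addEnergy A A := by
  unfold Finset.addEnergy
  refine Finset.card_bij' (fun p _ => (p.1, (-p.2.2, -p.2.1))) (fun p _ => (p.1, (-p.2.2, -p.2.1)))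
    ?_ ?_ ?_ ?_
  · rintro ⟨⟨a, b⟩, c, d⟩ h
    simp at h ⊢
    refine ⟨⟨h.1.1, h.1.2.2, h.1.2.1⟩, by omega⟩
  · rintro ⟨⟨a, b⟩, c, d⟩ h
    simp at h ⊢
    refine ⟨⟨h.1.1, h.1.2.2, h.1.2.1⟩, by omega⟩
  · rintro ⟨⟨a, b⟩, c, d⟩ h
    simp
  · rintro ⟨⟨a, b⟩, c, d⟩ h
    simp

lemma l4_final (K n m E : ℝ) (hK : 0 < K) (hn : 0 < n) (hm : 0 ≤ m)
    (h1 : n ^ 2 * n ^ 2 ≤ m * E) (h2 : E ≤ K ^ 4 * n ^ 2) : n ^ 2 / K ^ 4 ≤ m := by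
  rw [div_le_iff₀ (by positivity)]
  have h3 : n ^ 2 * n ^ 2 ≤ (m * K ^ 4) * n ^ 2 :=
    h1.trans ((mul_le_mul_of_nonneg_left h2 hm).trans (le_of_eq (by ring)))
  exact le_of_mul_le_mul_right h3 (by positivity)

theorem stmt_13 (S : Set ℤ) (K : ℝ) (hK : 0 < K) (hS : SatisfiesLambda4 S K) :
    ∀ S' : Set ℤ, S' ⊆ S → S'.Finite → S'.Nonempty →
      (S'.ncard : ℝ) ^ 2 / K ^ 4 ≤ ((S' + S').ncard : ℝ) ∧
      (S'.ncard : ℝ) ^ 2 / K ^ 4 ≤ ((S' - S').ncard : ℝ) := by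
  classical
  intro S' hS' hfin hne
  lift S' to Finset ℤ using hfin
  have hE := l4_energy_le S K hK hS S' hS'
  have hn : (0 : ℝ) < (S'.card : ℝ) := by
    exact_mod_cast Finset.card_pos.mpr (by simpa using hne)
  rw [← Finset.coe_add, ← Finset.coe_sub]
  simp only [Set.ncard_coe_finset]
  constructor
  · have h := Finset.le_card_add_mul_addEnergy S' S'
    exact l4_final K _ _ _ hK hn (by positivity) (by exact_mod_cast h) hE
  · have h := Finset.le_card_add_mul_addEnergy S' (-S')
    rw [l4_energy_neg, Finset.card_neg, ← sub_eq_add_neg] at h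
    exact l4_final K _ _ _ hK hn (by positivity) (by exact_mod_cast h) hE
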